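/- arXiv:2507.13308 — 7 statements merged into one kernel-verified Lean document; each statement's English description precedes it below -/
import Mathlib

section
/- Fix natural numbers S ≥ 1, n ≥ 1 and 0 ≤ k ≤ S·n. Let (m_1, …, m_n) be natural numbers with m_i ≤ S for all i and m_1 + ⋯ + m_n = k, and set j_i := m_1 + ⋯ + m_{i−1} (so j_1 = 0). Then the telescoping product of MPS coefficients ∏_{i=1}^n √( C(S(n−i), k − j_i − m_i) · C(S, m_i) / C(S(n−i+1), k − j_i) ) equals √( ∏_{i=1}^n C(S, m_i) / C(S·n, k) ). (The canonical MPS of [Raveh–Nepomechie] reproduces the spin-s Dicke amplitudes.) -/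
open Finset

/-- The partial sum before a successor site splits off the first entry. -/
theorem sum_Iio_fin_succ {n : ℕ} (m : Fin (n + 1) → ℕ) (i : Fin n) :
    ∑ t ∈ Finset.Iio i.succ, m t = m 0 + ∑ t ∈ Finset.Iio i, m t.succ := by
  have h : Finset.Iio i.succ = insert 0 ((Finset.Iio i).map (Fin.succEmb n)) := by
    ext t
    refine Fin.cases ?_ (fun t => ?_) t <;> simp
  rw [h, Finset.sum_insert (by simp), Finset.sum_map]
  rfl

theorem prod_choose_ratio_telescope (S n : ℕ) (m : Fin n → ℕ) (hm : ∀ i, m i ≤ S) :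
    (∏ i : Fin n,
      (((Nat.choose (S * (n - (i : ℕ) - 1))
            ((∑ t, m t) - (∑ t ∈ Finset.Iio i, m t) - m i) *
          Nat.choose S (m i) : ℕ) : ℝ) /
        ((Nat.choose (S * (n - (i : ℕ))) ((∑ t, m t) - ∑ t ∈ Finset.Iio i, m t) : ℕ) : ℝ)))
    = (∏ i, (Nat.choose S (m i) : ℝ)) / ((Nat.choose (S * n) (∑ t, m t) : ℕ) : ℝ) := by
  induction n with
  | zero => simp
  | succ n ih =>
    have htail : ∑ t : Fin n, m t.succ ≤ S * n := by
      simpa [mul_comm] using Finset.sum_le_card_nsmul Finset.univ (fun t : Fin n => m t.succ) S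
        (fun t _ => hm t.succ)
    have hne : ((S * n).choose (∑ t : Fin n, m t.succ) : ℝ) ≠ 0 := by
      exact_mod_cast (Nat.choose_pos htail).ne'
    have hfirst : Finset.Iio (0 : Fin (n + 1)) = ∅ := by
      ext t
      simp
    have ih := ih (fun t => m t.succ) (fun t => hm t.succ)
    rw [Fin.prod_univ_succ, Fin.prod_univ_succ, Fin.sum_univ_succ]
    simp only [sum_Iio_fin_succ, hfirst, Nat.add_sub_add_left, Fin.val_succ, Fin.val_zero,
      Nat.sub_zero, Finset.sum_empty, Nat.add_sub_add_right, Nat.add_sub_cancel,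
      Nat.add_sub_cancel_left]
    rw [ih]
    push_cast
    field_simp

/-- The telescoping product of the MPS coefficients `γ^{(i)}_{j_i, m_i}` of the canonical
spin-s Dicke MPS reproduces the Dicke amplitude `√(∏ C(S,m_i) / C(S·n,k))`.
Here the site index `i : Fin n` is zero-based, corresponding to site `i+1 ∈ {1,…,n}`,
so `S(n−(i+1)) = S*(n−i−1)` and `S(n−(i+1)+1) = S*(n−i)`; and
`j_i = m_1 + ⋯ + m_{i−1}` is the partial digit sum `∑ t ∈ Iio i, m t`. -/
theorem spin_s_dicke_mps_amplitude (S n k : ℕ) (hS : 1 ≤ S) (hn : 1 ≤ n)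
    (hk : k ≤ S * n) (m : Fin n → ℕ) (hm : ∀ i, m i ≤ S) (hsum : ∑ i, m i = k) :
    (∏ i : Fin n,
      Real.sqrt (((Nat.choose (S * (n - (i : ℕ) - 1))
            (k - (∑ t ∈ Finset.Iio i, m t) - m i) *
          Nat.choose S (m i) : ℕ) : ℝ) /
        ((Nat.choose (S * (n - (i : ℕ))) (k - ∑ t ∈ Finset.Iio i, m t) : ℕ) : ℝ)))
    = Real.sqrt ((∏ i, (Nat.choose S (m i) : ℝ)) / ((Nat.choose (S * n) k : ℕ) : ℝ)) := by
  subst hsum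
  rw [← prod_choose_ratio_telescope S n m hm, Real.sqrt_prod]
  intro i _
  positivity
end

section
/- Let N and k be natural numbers with N ≥ 2 and 1 ≤ k ≤ N − 1. Then N! · k^k · (N−k)^{N−k} / ( N^N · k! · (N−k)! ) ≥ e^{−1/6} · √( N / (2π k (N−k)) ). (Quantitative form of the Stirling estimate P(k) ≈ √(2sn / (2πk(2sn−k))) for the optimal success probability of the QPE preparation of |D^{(s)}_{n,k}⟩ with N = 2sn and p = k/N; hence the expected number of repetitions is O(√(sn)).) -/
/-- The Stirling sequence exceeds its limit `√π` by a factor of at most `e^{1/12}`. -/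
theorem stirlingSeq_le_exp_mul_sqrt_pi {n : ℕ} (hn : n ≠ 0) :
    Stirling.stirlingSeq n ≤ Real.exp (1 / 12) * Real.sqrt Real.pi := by
  obtain ⟨n, rfl⟩ := Nat.exists_eq_succ_of_ne_zero hn
  have h_first : Stirling.stirlingSeq (n + 1) ≤ Stirling.stirlingSeq 1 :=
    Stirling.stirlingSeq'_antitone (Nat.zero_le n)
  refine h_first.trans ?_
  refine ge_of_tendsto' ((Stirling.tendsto_stirlingSeq_sqrt_pi.comp
    (Filter.tendsto_add_atTop_nat 1)).const_mul (Real.exp (1 / 12))) fun m => ?_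
  have hm := Stirling.stirlingSeq'_pos m
  have h_log := Stirling.log_stirlingSeq_bounded_aux m
  change Stirling.stirlingSeq 1 ≤ Real.exp (1 / 12) * Stirling.stirlingSeq (m + 1)
  rw [← Real.log_le_log_iff (Stirling.stirlingSeq'_pos 0) (by positivity),
    Real.log_mul (by positivity) hm.ne', Real.log_exp]
  norm_num at h_log ⊢
  linarith

theorem factorial_eq_stirlingSeq_mul {n : ℕ} (hn : n ≠ 0) :
    (Nat.factorial n : ℝ) =
      Stirling.stirlingSeq n * (Real.sqrt 2 * Real.sqrt n * ((n : ℝ) ^ n / Real.exp 1 ^ n)) := by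
  rw [Stirling.stirlingSeq, ← div_pow, ← Real.sqrt_mul zero_le_two, div_mul_cancel₀]
  positivity

/-- The binomial probability of `k` successes in `k + m` trials with success probability
`k / (k + m)`, in terms of the Stirling sequence. -/
theorem binomial_peak_eq_stirlingSeq {k m : ℕ} (hk : k ≠ 0) (hm : m ≠ 0) :
    (Nat.factorial (k + m) : ℝ) * (k : ℝ) ^ k * (m : ℝ) ^ m /
        (((k + m : ℕ) : ℝ) ^ (k + m) * (Nat.factorial k : ℝ) * (Nat.factorial m : ℝ)) =
      Stirling.stirlingSeq (k + m) / (Stirling.stirlingSeq k * Stirling.stirlingSeq m) *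
        (Real.sqrt ((k + m : ℕ) : ℝ) / (Real.sqrt 2 * Real.sqrt k * Real.sqrt m)) := by
  have hkm : k + m ≠ 0 := by omega
  have hsk : Stirling.stirlingSeq k ≠ 0 :=
    ((Real.sqrt_pos.2 Real.pi_pos).trans_le (Stirling.sqrt_pi_le_stirlingSeq hk)).ne'
  have hsm : Stirling.stirlingSeq m ≠ 0 :=
    ((Real.sqrt_pos.2 Real.pi_pos).trans_le (Stirling.sqrt_pi_le_stirlingSeq hm)).ne'
  rw [factorial_eq_stirlingSeq_mul hkm, factorial_eq_stirlingSeq_mul hk,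
    factorial_eq_stirlingSeq_mul hm, pow_add (Real.exp 1)]
  have hpk : (k : ℝ) ^ k ≠ 0 := by positivity
  have hpm : (m : ℝ) ^ m ≠ 0 := by positivity
  have hpkm : ((k + m : ℕ) : ℝ) ^ (k + m) ≠ 0 := by positivity
  have hek : Real.exp 1 ^ k ≠ 0 := by positivity
  have hem : Real.exp 1 ^ m ≠ 0 := by positivity
  have hrk : Real.sqrt (k : ℝ) ≠ 0 := by positivity
  have hrm : Real.sqrt (m : ℝ) ≠ 0 := by positivity
  have hr2 : Real.sqrt 2 ≠ 0 := by positivity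
  generalize (k : ℝ) ^ k = pk at *
  generalize (m : ℝ) ^ m = pm at *
  generalize ((k + m : ℕ) : ℝ) ^ (k + m) = pkm at *
  generalize Real.exp 1 ^ k = ek at *
  generalize Real.exp 1 ^ m = em at *
  generalize Real.sqrt (k : ℝ) = rk at *
  generalize Real.sqrt (m : ℝ) = rm at *
  generalize Real.sqrt 2 = r2 at *
  field_simp

/-- Quantitative Stirling lower bound on the optimal QPE success probability:
for `2 ≤ N` and `1 ≤ k ≤ N−1`,
`N! k^k (N−k)^{N−k} / (N^N k! (N−k)!) ≥ e^{−1/6} √(N/(2π k (N−k)))`. -/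
theorem qpe_success_probability_stirling (N k : ℕ) (hN : 2 ≤ N)
    (hk1 : 1 ≤ k) (hk2 : k ≤ N - 1) :
    (Nat.factorial N : ℝ) * (k : ℝ) ^ k * ((N - k : ℕ) : ℝ) ^ (N - k) /
        ((N : ℝ) ^ N * (Nat.factorial k : ℝ) * (Nat.factorial (N - k) : ℝ))
    ≥ Real.exp (-(1 / 6)) *
        Real.sqrt ((N : ℝ) / (2 * Real.pi * (k : ℝ) * ((N - k : ℕ) : ℝ))) := by
  obtain ⟨m, rfl⟩ : ∃ m, N = k + m := Nat.exists_eq_add_of_le (by omega)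
  have hk : k ≠ 0 := by omega
  have hm : m ≠ 0 := by omega
  rw [Nat.add_sub_cancel_left, binomial_peak_eq_stirlingSeq hk hm, ge_iff_le]
  have h_pi : 0 < Real.sqrt Real.pi := Real.sqrt_pos.2 Real.pi_pos
  have hsk := h_pi.trans_le (Stirling.sqrt_pi_le_stirlingSeq hk)
  have hsm := h_pi.trans_le (Stirling.sqrt_pi_le_stirlingSeq hm)
  have h_sqrt : Real.sqrt (((k + m : ℕ) : ℝ) / (2 * Real.pi * k * m)) =
      (Real.sqrt Real.pi)⁻¹ *
        (Real.sqrt ((k + m : ℕ) : ℝ) / (Real.sqrt 2 * Real.sqrt k * Real.sqrt m)) := by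
    rw [Real.sqrt_div (by positivity), Real.sqrt_mul (by positivity),
      Real.sqrt_mul (by positivity), Real.sqrt_mul (by positivity)]
    field_simp
  rw [h_sqrt, ← mul_assoc]
  refine mul_le_mul_of_nonneg_right ?_ (by positivity)
  rw [le_div_iff₀ (by positivity)]
  have h_exp : Real.exp (-(1 / 6)) * (Real.exp (1 / 12) * Real.exp (1 / 12)) = 1 := by
    rw [← Real.exp_add, ← Real.exp_add]
    norm_num
  calc Real.exp (-(1 / 6)) * (Real.sqrt Real.pi)⁻¹ *
        (Stirling.stirlingSeq k * Stirling.stirlingSeq m)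
      ≤ Real.exp (-(1 / 6)) * (Real.sqrt Real.pi)⁻¹ *
        ((Real.exp (1 / 12) * Real.sqrt Real.pi) * (Real.exp (1 / 12) * Real.sqrt Real.pi)) := by
        gcongr
        · exact stirlingSeq_le_exp_mul_sqrt_pi hk
        · exact stirlingSeq_le_exp_mul_sqrt_pi hm
    _ = Real.exp (-(1 / 6)) * (Real.exp (1 / 12) * Real.exp (1 / 12)) * Real.sqrt Real.pi := by
        field_simp
    _ = Real.sqrt Real.pi := by rw [h_exp, one_mul]
    _ ≤ Stirling.stirlingSeq (k + m) := Stirling.sqrt_pi_le_stirlingSeq (by omega)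
end

section
/- Let D ≥ 1 be a natural number and a : Fin D → ℝ with a_m ≥ 0 for all m and ∑_{m=0}^{D−1} a_m² = 1. Set t_m := √(1 − ∑_{q<m} a_q²) and assume t_m > 0 for all m < D − 1. Define θ_m := 2·arccos(a_m / t_m) for m < D − 1. Then for every m < D − 1, cos(θ_m/2) · ∏_{p<m} sin(θ_p/2) = a_m, and ∏_{p<D−1} sin(θ_p/2) = a_{D−1}. (Correctness of the sequential rotation-gate construction R_{D−2,D−1}(θ_{D−2}) ⋯ R_{0,1}(θ_0)|0⟩ producing a prescribed nonnegative amplitude vector.) -/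
open Finset

theorem Fin.Iio_mk_succ {D n : ℕ} (h : n + 1 < D) :
    Finset.Iio (⟨n + 1, h⟩ : Fin D) =
      insert ⟨n, Nat.lt_of_succ_lt h⟩ (Finset.Iio ⟨n, Nat.lt_of_succ_lt h⟩) := by
  ext p
  simp only [Finset.mem_Iio, Finset.mem_insert, Fin.lt_def, Fin.ext_iff]
  omega

theorem Real.mul_sin_arccos_div {x r : ℝ} (hr : 0 < r) :
    r * Real.sin (Real.arccos (x / r)) = √(r ^ 2 - x ^ 2) := by
  have h : r ^ 2 - x ^ 2 = r ^ 2 * (1 - (x / r) ^ 2) := by field_simp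
  rw [Real.sin_arccos, h, Real.sqrt_mul (sq_nonneg r), Real.sqrt_sq hr.le]

/-- The sines of the half-angles telescope to the norm of the remaining amplitudes. -/
theorem prod_sin_half_rotation_angle {D : ℕ} {a t θ : Fin D → ℝ}
    (ht : ∀ m, t m = Real.sqrt (1 - ∑ q ∈ Finset.Iio m, (a q) ^ 2))
    (htpos : ∀ m : Fin D, (m : ℕ) < D - 1 → 0 < t m)
    (hθ : ∀ m : Fin D, (m : ℕ) < D - 1 → θ m = 2 * Real.arccos (a m / t m))
    (m : Fin D) : ∏ p ∈ Finset.Iio m, Real.sin (θ p / 2) = t m := by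
  obtain ⟨n, hn⟩ := m
  induction n with
  | zero =>
    have h : Finset.Iio (⟨0, hn⟩ : Fin D) = ∅ := by ext p; simp [Fin.lt_def]
    simp [ht, h]
  | succ n ih =>
    have hlt : n < D - 1 := by omega
    have hpos := htpos ⟨n, by omega⟩ hlt
    have hsq : t ⟨n, by omega⟩ ^ 2 = 1 - ∑ q ∈ Finset.Iio (⟨n, by omega⟩ : Fin D), a q ^ 2 := by
      rw [ht, Real.sqrt_pos] at hpos
      rw [ht, Real.sq_sqrt hpos.le]
    rw [Fin.Iio_mk_succ, Finset.prod_insert (by simp), ih, hθ _ hlt,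
      mul_div_cancel_left₀ _ two_ne_zero, mul_comm, Real.mul_sin_arccos_div hpos, hsq, ht,
      Fin.Iio_mk_succ, Finset.sum_insert (by simp)]
    congr 1
    ring

/-- Correctness of the sequential rotation-gate construction producing a prescribed
nonnegative amplitude vector `a` with `∑ a_m² = 1`: with `t_m = √(1 − ∑_{q<m} a_q²)`
assumed positive for `m < D−1`, and `θ_m = 2·arccos(a_m / t_m)`, one has
`cos(θ_m/2)·∏_{p<m} sin(θ_p/2) = a_m` for all `m < D−1`, and
`∏_{p<D−1} sin(θ_p/2) = a_{D−1}`. -/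
theorem rotation_gate_amplitudes (D : ℕ) (hD : 1 ≤ D) (a : Fin D → ℝ)
    (ha : ∀ m, 0 ≤ a m) (hsum : ∑ m, (a m) ^ 2 = 1)
    (t θ : Fin D → ℝ)
    (ht : ∀ m, t m = Real.sqrt (1 - ∑ q ∈ Finset.Iio m, (a q) ^ 2))
    (htpos : ∀ m : Fin D, (m : ℕ) < D - 1 → 0 < t m)
    (hθ : ∀ m : Fin D, (m : ℕ) < D - 1 → θ m = 2 * Real.arccos (a m / t m)) :
    (∀ m : Fin D, (m : ℕ) < D - 1 →
      Real.cos (θ m / 2) * ∏ p ∈ Finset.Iio m, Real.sin (θ p / 2) = a m) ∧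
    (∏ p ∈ Finset.univ.filter (fun p : Fin D => (p : ℕ) < D - 1),
        Real.sin (θ p / 2)) = a ⟨D - 1, by omega⟩ := by
  have hprod := prod_sin_half_rotation_angle ht htpos hθ
  constructor
  · intro m hm
    have hpos := htpos m hm
    have hle : a m ≤ t m := by
      have hsub := Finset.sum_le_sum_of_subset_of_nonneg
        (Finset.subset_univ (insert m (Finset.Iio m))) (fun q _ _ => sq_nonneg (a q))
      rw [Finset.sum_insert (by simp), hsum] at hsub
      rw [ht]
      exact Real.le_sqrt_of_sq_le (by linarith)
    rw [hprod, hθ m hm, mul_div_cancel_left₀ _ two_ne_zero,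
      Real.cos_arccos (by linarith [div_nonneg (ha m) hpos.le]) ((div_le_one hpos).2 hle),
      div_mul_cancel₀ _ hpos.ne']
  · have hlast : Finset.univ.filter (fun p : Fin D => (p : ℕ) < D - 1) =
        Finset.Iio ⟨D - 1, by omega⟩ := by
      ext p
      simp [Fin.lt_def]
    have huniv : (Finset.univ : Finset (Fin D)) =
        insert ⟨D - 1, by omega⟩ (Finset.Iio ⟨D - 1, by omega⟩) := by
      ext p
      simp only [Finset.mem_univ, Finset.mem_insert, Finset.mem_Iio, Fin.lt_def, Fin.ext_iff,
        true_iff]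
      omega
    rw [huniv, Finset.sum_insert (by simp)] at hsum
    rw [hlast, hprod, ht, ← hsum, add_sub_cancel_right, Real.sqrt_sq (ha _)]
end

section
/- Fix d ≥ 1 and k : Fin d → ℕ, let i be a natural number, and let a ∈ A^{i}(k) with a(0) < k(0) (so that a + ê₀ ∈ A^{i+1}(k)). Then the number of elements of A^{i+1}(k) that are lexicographically greater than a + ê₀ is at most the number of elements of A^{i}(k) that are lexicographically greater than a; that is, J^{i+1}(a + ê₀) ≤ J^{i}(a). (Appendix Proposition, Eq. (proved).) -/
open Finset

/-- The level set `A^i(k)`: vectors `a : Fin d → ℕ` with `a j ≤ k j` for all `j`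
and `∑ j, a j = i`. -/
def levelSet (d : ℕ) (k : Fin d → ℕ) (i : ℕ) : Finset (Fin d → ℕ) :=
  (Fintype.piFinset fun j => Finset.range (k j + 1)).filter fun a => ∑ j, a j = i

/-- Lexicographic comparison from left to right: `x >_lex y` iff `x j > y j` at the
first index `j` where they differ. -/
def lexGT {d : ℕ} (x y : Fin d → ℕ) : Prop :=
  ∃ j : Fin d, (∀ j' : Fin d, j' < j → x j' = y j') ∧ y j < x j

/-- The unit vector `ê₀ = (1,0,…,0)`. -/
def unit0 (d : ℕ) : Fin d → ℕ := fun j => if (j : ℕ) = 0 then 1 else 0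

open scoped Classical in
/-- The index of `a` in the reverse lexicographic ordering of `A^i(k)`:
the number of elements of `A^i(k)` lexicographically greater than `a`. -/
noncomputable def lexIndex (d : ℕ) (k : Fin d → ℕ) (i : ℕ) (a : Fin d → ℕ) : ℕ :=
  ((levelSet d k i).filter fun x => lexGT x a).card

/-- Appendix Proposition: for `a ∈ A^i(k)` with `a 0 < k 0`,
`J^{i+1}(a + ê₀) ≤ J^i(a)`. -/
theorem appendix_proposition (d : ℕ) (hd : 1 ≤ d) (k : Fin d → ℕ) (i : ℕ)
    (a : Fin d → ℕ) (ha : a ∈ levelSet d k i) (ha0 : a ⟨0, hd⟩ < k ⟨0, hd⟩) :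
    lexIndex d k (i + 1) (a + unit0 d) ≤ lexIndex d k i a := by
  classical
  obtain ⟨n, rfl⟩ : ∃ n, d = n + 1 := ⟨d - 1, by omega⟩
  have head_pos : ∀ x : Fin (n + 1) → ℕ, lexGT x (a + unit0 (n + 1)) → 1 ≤ x 0 := by
    rintro x ⟨j, hj, hlt⟩
    rcases Fin.eq_zero_or_eq_succ j with rfl | ⟨m, rfl⟩
    · exact Nat.one_le_of_lt hlt
    · have h := hj 0 (Fin.succ_pos m)
      simp [unit0] at h
      omega
  have sub_add : ∀ x : Fin (n + 1) → ℕ, 1 ≤ x 0 →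
      x - unit0 (n + 1) + unit0 (n + 1) = x := by
    intro x hx
    funext j
    rcases Fin.eq_zero_or_eq_succ j with rfl | ⟨m, rfl⟩
    · simp [unit0]
      omega
    · simp [unit0]
  refine Finset.card_le_card_of_injOn (fun x => x - unit0 (n + 1)) ?_ ?_
  · intro x hx
    simp only [Finset.mem_coe, Finset.mem_filter, levelSet, Fintype.mem_piFinset,
      Finset.mem_range] at hx ⊢
    obtain ⟨⟨hk, hsum⟩, hgt⟩ := hx
    have hx0 := head_pos x hgt
    have hsub := sub_add x hx0
    refine ⟨⟨fun j => (Nat.sub_le _ _).trans_lt (hk j), ?_⟩, ?_⟩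
    · have h0 : (x - unit0 (n + 1)) 0 = x 0 - 1 := by simp [unit0]
      have hs : ∀ m : Fin n, (x - unit0 (n + 1)) m.succ = x m.succ := by simp [unit0]
      rw [Fin.sum_univ_succ] at hsum ⊢
      simp only [h0, hs]
      omega
    · obtain ⟨j, hj, hlt⟩ := hgt
      rw [← hsub] at hj hlt
      exact ⟨j, fun j' h => Nat.add_right_cancel (hj j' h), Nat.lt_of_add_lt_add_right hlt⟩
  · intro x hx y hy hxy
    simp only [Finset.mem_coe, Finset.mem_filter] at hx hy
    rw [← sub_add x (head_pos x hx.2), ← sub_add y (head_pos y hy.2)]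
    exact congrArg (· + unit0 (n + 1)) hxy
end

section
/- Fix d ≥ 1 and k : Fin d → ℕ, let i be a natural number with i + 1 ≤ k(0), and let a ∈ A^{i}(k) (note a(0) ≤ i < k(0) so a + ê₀ ∈ A^{i+1}(k)). Then J^{i+1}(a + ê₀) = J^{i}(a): the number of elements of A^{i+1}(k) lexicographically greater than a + ê₀ equals the number of elements of A^{i}(k) lexicographically greater than a. -/
open Finset


open Finset

theorem mem_levelSet {d : ℕ} {k : Fin d → ℕ} {i : ℕ} {a : Fin d → ℕ} :
    a ∈ levelSet d k i ↔ (∀ j, a j ≤ k j) ∧ ∑ j, a j = i := by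
  simp [levelSet]

theorem lexGT_add_right {d : ℕ} (x y z : Fin d → ℕ) :
    lexGT (x + z) (y + z) ↔ lexGT x y := by
  simp [lexGT]

theorem lexGT.apply_zero_le {d : ℕ} {x y : Fin d → ℕ} (hd : 1 ≤ d) (h : lexGT x y) :
    y ⟨0, hd⟩ ≤ x ⟨0, hd⟩ := by
  obtain ⟨j, heq, hlt⟩ := h
  by_cases hj : j = ⟨0, hd⟩
  · exact hj ▸ hlt.le
  · refine (heq _ (Fin.lt_def.2 ?_)).ge
    exact Nat.pos_of_ne_zero fun h => hj (Fin.ext h)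

theorem sum_unit0 {d : ℕ} (hd : 1 ≤ d) : ∑ j, unit0 d j = 1 := by
  rw [Finset.sum_eq_single ⟨0, hd⟩]
  · simp [unit0]
  · intro j _ hj
    exact if_neg fun h => hj (Fin.ext h)
  · simp

theorem add_unit0_mem_levelSet {d : ℕ} (hd : 1 ≤ d) {k : Fin d → ℕ} {i : ℕ}
    (hik : i + 1 ≤ k ⟨0, hd⟩) {x : Fin d → ℕ} :
    x + unit0 d ∈ levelSet d k (i + 1) ↔ x ∈ levelSet d k i := by
  simp only [mem_levelSet, Pi.add_apply, Finset.sum_add_distrib, sum_unit0 hd,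
    Nat.add_right_cancel_iff]
  refine and_congr_left fun hsum => forall_congr' fun j => ?_
  by_cases hj : j = ⟨0, hd⟩
  · have hle : x j ≤ i := hsum ▸ Finset.single_le_sum (fun _ _ => Nat.zero_le _) (mem_univ j)
    subst hj
    simp only [unit0, if_true]
    omega
  · have : (j : ℕ) ≠ 0 := fun h => hj (Fin.ext h)
    simp [unit0, this]

theorem unit0_le_of_pos {d : ℕ} (hd : 1 ≤ d) {y : Fin d → ℕ} (hy : 1 ≤ y ⟨0, hd⟩) :
    unit0 d ≤ y := by
  intro j
  by_cases hj : j = ⟨0, hd⟩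
  · subst hj
    simpa [unit0] using hy
  · have : (j : ℕ) ≠ 0 := fun h => hj (Fin.ext h)
    simp [unit0, this]

/-- If `i + 1 ≤ k 0`, then for `a ∈ A^i(k)` the index is preserved:
`J^{i+1}(a + ê₀) = J^i(a)`. -/
theorem index_equality_small_i (d : ℕ) (hd : 1 ≤ d) (k : Fin d → ℕ) (i : ℕ)
    (hik : i + 1 ≤ k ⟨0, hd⟩) (a : Fin d → ℕ) (ha : a ∈ levelSet d k i) :
    lexIndex d k (i + 1) (a + unit0 d) = lexIndex d k i a := by
  classical
  unfold lexIndex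
  symm
  refine Finset.card_bij (fun x _ => x + unit0 d) ?_ (fun _ _ _ _ h => add_right_cancel h) ?_
  · intro x hx
    rw [Finset.mem_filter] at hx ⊢
    exact ⟨(add_unit0_mem_levelSet hd hik).2 hx.1, (lexGT_add_right _ _ _).2 hx.2⟩
  · intro y hy
    rw [Finset.mem_filter] at hy
    have hpos : 1 ≤ y ⟨0, hd⟩ :=
      le_trans (by simp [unit0]) (hy.2.apply_zero_le hd)
    have hsub : y - unit0 d + unit0 d = y := tsub_add_cancel_of_le (unit0_le_of_pos hd hpos)
    rw [← hsub] at hy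
    exact ⟨y - unit0 d, Finset.mem_filter.2
      ⟨(add_unit0_mem_levelSet hd hik).1 hy.1, (lexGT_add_right _ _ _).1 hy.2⟩, hsub⟩
end

section
/- Let d ≥ 1 and n ≥ 1 be natural numbers and k : Fin d → ℕ with k(i) ≥ 1 for all i and ∑_i k(i) = n. Then n! · ∏_i k(i)^{k(i)} / ( n^n · ∏_i k(i)! ) ≥ e^{−d/12} · √( n / ( (2π)^{d−1} · ∏_i k(i) ) ). (Quantitative form of the Stirling estimate P(k⃗) ≈ √( n / ((2π)^{d−1} ∏_i k_i) ) for the optimal success probability of the QPE preparation of |D^n(k⃗)⟩; hence at worst, for k⃗ = (n/d,…,n/d), the expected number of repetitions is O(n^{(d−1)/2}).) -/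
open Finset

/-- A factorial upper bound matching `Stirling.le_factorial_stirling` up to the factor
`exp (1 / 12)`. -/
theorem factorial_le_exp_mul_stirling {n : ℕ} (hn : n ≠ 0) :
    (Nat.factorial n : ℝ) ≤
      Real.exp (1 / 12) * (√(2 * Real.pi * n) * (n / Real.exp 1) ^ n) := by
  obtain ⟨m, rfl⟩ := Nat.exists_eq_succ_of_ne_zero hn
  have hlim : Filter.Tendsto
      (fun j : ℕ => Real.log (Stirling.stirlingSeq 1) - Real.log (Stirling.stirlingSeq (j + 1)))
      Filter.atTop (nhds (Real.log (Stirling.stirlingSeq 1) - Real.log √Real.pi)) :=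
    ((Stirling.tendsto_stirlingSeq_sqrt_pi.comp (Filter.tendsto_add_atTop_nat 1)).log
      (by positivity)).const_sub _
  have hlog := le_of_tendsto' hlim Stirling.log_stirlingSeq_bounded_aux
  have hone : Stirling.stirlingSeq 1 ≤ Real.exp (1 / 12) * √Real.pi := by
    rw [← Real.log_le_log_iff (Stirling.stirlingSeq'_pos 0) (by positivity),
      Real.log_mul (by positivity) (by positivity), Real.log_exp]
    linarith
  have hseq : Stirling.stirlingSeq (m + 1) ≤ Real.exp (1 / 12) * √Real.pi :=
    (Stirling.stirlingSeq'_antitone (Nat.zero_le m)).trans hone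
  rw [Stirling.stirlingSeq, div_le_iff₀ (by positivity)] at hseq
  refine hseq.trans_eq ?_
  rw [show 2 * Real.pi * ((m.succ : ℕ) : ℝ) = Real.pi * (2 * ((m + 1 : ℕ) : ℝ)) by
    push_cast; ring, Real.sqrt_mul Real.pi_pos.le]
  simp only [Nat.succ_eq_add_one]
  ring

theorem prod_factorial_le_exp_mul_stirling {ι : Type*} (s : Finset ι) (k : ι → ℕ)
    (hk : ∀ i ∈ s, k i ≠ 0) :
    ∏ i ∈ s, (Nat.factorial (k i) : ℝ) ≤
      Real.exp (#s / 12) * √((2 * Real.pi) ^ #s * ∏ i ∈ s, (k i : ℝ)) *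
        ((∏ i ∈ s, (k i : ℝ) ^ k i) / Real.exp 1 ^ ∑ i ∈ s, k i) := by
  refine (Finset.prod_le_prod (fun i _ => by positivity)
    (fun i hi => factorial_le_exp_mul_stirling (hk i hi))).trans_eq ?_
  have hsqrt : ∏ i ∈ s, √(2 * Real.pi * k i) = √((2 * Real.pi) ^ #s * ∏ i ∈ s, (k i : ℝ)) := by
    rw [← Real.sqrt_prod s (fun i _ => by positivity), Finset.prod_mul_distrib,
      Finset.prod_const]
  simp only [div_pow, Finset.prod_mul_distrib, Finset.prod_div_distrib, Finset.prod_const,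
    hsqrt, Finset.prod_pow_eq_pow_sum]
  rw [← Real.exp_nat_mul, mul_one_div, mul_assoc]

/-- Quantitative Stirling lower bound on the optimal QPE success probability for
SU(d) Dicke states: for `k : Fin d → ℕ` with `k i ≥ 1` and `∑ k_i = n`,
`n! ∏ k_i^{k_i} / (n^n ∏ k_i!) ≥ e^{−d/12} √( n / ((2π)^{d−1} ∏ k_i) )`. -/
theorem sud_qpe_success_probability_stirling (d n : ℕ) (hd : 1 ≤ d) (hn : 1 ≤ n)
    (k : Fin d → ℕ) (hk1 : ∀ i, 1 ≤ k i) (hk : ∑ i, k i = n) :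
    (Nat.factorial n : ℝ) * (∏ i, (k i : ℝ) ^ k i) /
        ((n : ℝ) ^ n * ∏ i, (Nat.factorial (k i) : ℝ))
    ≥ Real.exp (-(d : ℝ) / 12) *
        Real.sqrt ((n : ℝ) / ((2 * Real.pi) ^ (d - 1) * ∏ i, (k i : ℝ))) := by
  obtain ⟨m, rfl⟩ := Nat.exists_eq_add_of_le' hd
  have hkpos : ∀ i, (0 : ℝ) < k i := fun i => by exact_mod_cast hk1 i
  have hP : 0 < ∏ i, (k i : ℝ) := Finset.prod_pos fun i _ => hkpos i
  have hupper := prod_factorial_le_exp_mul_stirling univ k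
    fun i _ => Nat.one_le_iff_ne_zero.mp (hk1 i)
  rw [hk, Finset.card_univ, Fintype.card_fin] at hupper
  have hlower := Stirling.le_factorial_stirling n
  have hsqrt : √((n : ℝ) / ((2 * Real.pi) ^ m * ∏ i, (k i : ℝ))) *
      √((2 * Real.pi) ^ (m + 1) * ∏ i, (k i : ℝ)) = √(2 * Real.pi * n) := by
    rw [← Real.sqrt_mul (by positivity)]
    congr 1
    field_simp
    ring
  have hexp : Real.exp (-((m + 1 : ℕ) : ℝ) / 12) * Real.exp (((m + 1 : ℕ) : ℝ) / 12) = 1 := by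
    rw [← Real.exp_add, neg_div, neg_add_cancel, Real.exp_zero]
  rw [ge_iff_le, Nat.add_sub_cancel, le_div_iff₀ (by positivity)]
  calc
    _ ≤ Real.exp (-((m + 1 : ℕ) : ℝ) / 12) * √(n / ((2 * Real.pi) ^ m * ∏ i, (k i : ℝ))) *
        (n ^ n * (Real.exp (((m + 1 : ℕ) : ℝ) / 12) *
          √((2 * Real.pi) ^ (m + 1) * ∏ i, (k i : ℝ)) *
            ((∏ i, (k i : ℝ) ^ k i) / Real.exp 1 ^ n))) := by gcongr
    _ = √(2 * Real.pi * n) * (n / Real.exp 1) ^ n * ∏ i, (k i : ℝ) ^ k i := by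
      rw [← hsqrt, div_pow]
      linear_combination (√(n / ((2 * Real.pi) ^ m * ∏ i, (k i : ℝ))) *
        √((2 * Real.pi) ^ (m + 1) * ∏ i, (k i : ℝ)) * (n ^ n / Real.exp 1 ^ n) *
          ∏ i, (k i : ℝ) ^ k i) * hexp
    _ ≤ _ := by gcongr
end

section
/- Fix natural numbers d ≥ 1, n, r with 1 ≤ r ≤ d − 1, and x with 0 < x and r·x ≤ n. Let k : Fin d → ℕ be given by k(0) = n − r·x, k(j) = x for 1 ≤ j ≤ r, and k(j) = 0 for j > r. Then for every natural number i, the cardinality of the level set satisfies #A^i(k) ≤ (x+1)^r. (Bound on the bond dimension χ of the SU(d) Dicke MPS for occupation vectors of the form (n−rx, x, …, x, 0, …, 0), giving sequential preparation depth O(x^r n).) -/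
open Finset

/-- Bound on the bond dimension of the SU(d) Dicke MPS for occupation vectors of the
form `k⃗ = (n − r·x, x, …, x, 0, …, 0)` (with `r` copies of `x`): for every `i`,
`#A^i(k) ≤ (x+1)^r`. -/
theorem levelSet_card_le_special (d n r x : ℕ) (hd : 1 ≤ d) (hr1 : 1 ≤ r)
    (hr2 : r ≤ d - 1) (hx : 0 < x) (hrx : r * x ≤ n)
    (k : Fin d → ℕ) (hk0 : k ⟨0, hd⟩ = n - r * x)
    (hk1 : ∀ j : Fin d, 1 ≤ (j : ℕ) → (j : ℕ) ≤ r → k j = x)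
    (hk2 : ∀ j : Fin d, r < (j : ℕ) → k j = 0)
    (i : ℕ) :
    (levelSet d k i).card ≤ (x + 1) ^ r := by
  have hlt (t : Fin r) : (t : ℕ) + 1 < d := by have := t.isLt; omega
  let tail : (Fin d → ℕ) → Fin r → ℕ := fun a t => a ⟨t + 1, hlt t⟩
  have hcard : (Fintype.piFinset fun _ : Fin r => Finset.range (x + 1)).card = (x + 1) ^ r := by
    simp
  rw [← hcard]
  refine Finset.card_le_card_of_injOn tail ?_ ?_
  · intro a ha
    simp only [levelSet, Finset.coe_filter, Set.mem_ofPred_eq, Fintype.mem_piFinset,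
      Finset.mem_range] at ha
    simp only [Finset.mem_coe, Fintype.mem_piFinset, Finset.mem_range, tail]
    intro t
    have ht := ha.1 ⟨t + 1, hlt t⟩
    rwa [hk1 ⟨t + 1, hlt t⟩ (Nat.le_add_left 1 t) t.isLt] at ht
  · intro a ha b hb hab
    simp only [levelSet, Finset.coe_filter, Set.mem_ofPred_eq, Fintype.mem_piFinset,
      Finset.mem_range] at ha hb
    have hne (j : Fin d) (hj : j ≠ ⟨0, hd⟩) : a j = b j := by
      have hj1 : 1 ≤ (j : ℕ) := Nat.one_le_iff_ne_zero.mpr fun h => hj (Fin.ext h)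
      rcases le_or_gt (j : ℕ) r with hjr | hjr
      · have h := congrFun hab ⟨j - 1, by omega⟩
        simpa only [tail, Nat.sub_add_cancel hj1] using h
      · have h1 := ha.1 j
        have h2 := hb.1 j
        rw [hk2 j hjr] at h1 h2
        omega
    have hsum : ∑ j ∈ Finset.univ.erase ⟨0, hd⟩, a j = ∑ j ∈ Finset.univ.erase ⟨0, hd⟩, b j :=
      Finset.sum_congr rfl fun j hj => hne j (Finset.ne_of_mem_erase hj)
    have hzero : a ⟨0, hd⟩ = b ⟨0, hd⟩ := by
      have h1 := Finset.add_sum_erase Finset.univ a (Finset.mem_univ ⟨0, hd⟩)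
      have h2 := Finset.add_sum_erase Finset.univ b (Finset.mem_univ ⟨0, hd⟩)
      rw [ha.2] at h1
      rw [hb.2] at h2
      omega
    funext j
    by_cases hj : j = ⟨0, hd⟩
    · rw [hj, hzero]
    · exact hne j hj
end
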